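/- Let v be a finite factor of the Thue–Morse word t such that either (a) v has 0110 or 1001 as a prefix and 0010 or 1101 as a suffix, or (b) v has 0100 or 1011 as a prefix and 0110 or 1001 as a suffix. Then the clipped Thue–Morse morphism f_v is cubefree. -/

import Mathlib

/-- The Thue–Morse word: `tm n` is the parity of the number of 1s in the
binary representation of `n` (`true` = letter 1, `false` = letter 0). -/
def tm (n : ℕ) : Bool := ((Nat.digits 2 n).count 1) % 2 == 1

/-- The factor `t[ℓ..ℓ+k-1]` of the Thue–Morse word. -/
def tmFactor (ℓ k : ℕ) : List Bool := (List.range k).map (fun i => tm (ℓ + i))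

/-- Complement of a binary word (exchange 0 and 1 in every position). -/
def wcompl (w : List Bool) : List Bool := w.map (fun b => !b)

/-- Apply the binary morphism `0 ↦ h0, 1 ↦ h1` to the word `w`. -/
def applyMorph (h0 h1 : List Bool) (w : List Bool) : List Bool :=
  (w.map (fun b => bif b then h1 else h0)).flatten

/-- The Thue–Morse morphism μ : 0 ↦ 01, 1 ↦ 10. -/
def mu : List Bool → List Bool := applyMorph [false, true] [true, false]

/-- `p` is a period of the finite word `w`: `1 ≤ p ≤ |w|` and `w[i] = w[i+p]`
for all `i` with `i + p < |w|`. -/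
def HasPeriodW (w : List Bool) (p : ℕ) : Prop :=
  1 ≤ p ∧ p ≤ w.length ∧ ∀ i, i + p < w.length → w.getD i false = w.getD (i + p) false

/-- The smallest period of `w`. -/
noncomputable def per (w : List Bool) : ℕ := sInf {p | HasPeriodW w p}

/-- The exponent of `w`: `|w| / per(w)`. -/
noncomputable def wexp (w : List Bool) : ℝ := (w.length : ℝ) / (per w : ℝ)

/-- The critical exponent of `w`: supremum of exponents of nonempty factors of `w`. -/
noncomputable def ce (w : List Bool) : ℝ :=
  sSup {r : ℝ | ∃ x : List Bool, x ≠ [] ∧ x <:+: w ∧ r = wexp x}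

/-- A `k`-prefix: the length-`k` prefix of the Thue–Morse word, or its complement. -/
def kPrefix (k : ℕ) (s : List Bool) : Prop :=
  s = tmFactor 0 k ∨ s = wcompl (tmFactor 0 k)

/-- `v` is a finite factor of the Thue–Morse word. -/
def IsTMFactor (v : List Bool) : Prop := ∃ ℓ, v = tmFactor ℓ v.length

/-- The complementary morphism `0 ↦ h0, 1 ↦ complement of h0` is cubefree:
it maps every word of critical exponent `< 3` to a word of critical exponent `< 3`. -/
def CubefreeC (h0 : List Bool) : Prop :=
  ∀ w : List Bool, ce w < 3 → ce (applyMorph h0 (wcompl h0) w) < 3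

/-- The word `x` occurs at position `i` of the word `w`. -/
def OccursAt (x w : List Bool) (i : ℕ) : Prop :=
  i + x.length ≤ w.length ∧ (w.drop i).take x.length = x

theorem tm_two_mul (n : ℕ) : tm (2 * n) = tm n := by
  rcases Nat.eq_zero_or_pos n with rfl | h
  · rfl
  · unfold tm
    rw [Nat.digits_def' (by norm_num) (by omega : 0 < 2 * n)]
    simp

theorem tm_two_mul_add_one (n : ℕ) : tm (2 * n + 1) = !tm n := by
  unfold tm
  rw [Nat.digits_def' (by norm_num) (by omega : 0 < 2 * n + 1)]
  have h1 : (2 * n + 1) % 2 = 1 := by omega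
  have h2 : (2 * n + 1) / 2 = n := by omega
  rw [h1, h2, List.count_cons_self]
  rcases Nat.mod_two_eq_zero_or_one ((Nat.digits 2 n).count 1) with h | h <;>
    simp [Nat.add_mod, h]

theorem tm_succ_ne_of_even {i : ℕ} (h : i % 2 = 0) : tm i ≠ tm (i + 1) := by
  obtain ⟨m, rfl⟩ : ∃ m, i = 2 * m := ⟨i / 2, by omega⟩
  simp [tm_two_mul, tm_two_mul_add_one]

/-- A sequence that changes at each of the `k` steps from `i` on has `x (i + k)` determined by
the parity of `k`. -/
theorem alternating_apply {x : ℕ → Bool} {i : ℕ} (k : ℕ)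
    (h : ∀ j < k, x (i + j) ≠ x (i + j + 1)) : x (i + k) = (x i ^^ decide (k % 2 = 1)) := by
  induction k with
  | zero => simp
  | succ k ih =>
    have h1 := ih fun j hj => h j (by omega)
    have h2 := h k (by omega)
    rw [← add_assoc]
    rcases Nat.mod_two_eq_zero_or_one k with hk | hk
    · have : (k + 1) % 2 = 1 := by omega
      simp only [hk, this] at *
      revert h1 h2; cases x (i + k) <;> cases x (i + k + 1) <;> cases x i <;> simp
    · have : (k + 1) % 2 = 0 := by omega
      simp only [hk, this] at *
      revert h1 h2; cases x (i + k) <;> cases x (i + k + 1) <;> cases x i <;> simp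

/-- The Thue–Morse word is overlap-free. -/
theorem tm_overlapFree (p : ℕ) : ∀ i, 1 ≤ p → ¬ ∀ k ≤ p, tm (i + k) = tm (i + k + p) := by
  induction p using Nat.strong_induction_on with
  | _ p ih =>
    intro i hp h
    rcases Nat.mod_two_eq_zero_or_one p with hp2 | hp2
    · obtain ⟨q, rfl⟩ : ∃ q, p = 2 * q := ⟨p / 2, by omega⟩
      refine ih q (by omega) (i / 2) (by omega) fun k hk => ?_
      have := h (2 * k) (by omega)
      rcases Nat.mod_two_eq_zero_or_one i with hi | hi
      · rwa [show i + 2 * k = 2 * (i / 2 + k) by omega,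
          show 2 * (i / 2 + k) + 2 * q = 2 * (i / 2 + k + q) by omega,
          tm_two_mul, tm_two_mul] at this
      · rwa [show i + 2 * k = 2 * (i / 2 + k) + 1 by omega,
          show 2 * (i / 2 + k) + 1 + 2 * q = 2 * (i / 2 + k + q) + 1 by omega,
          tm_two_mul_add_one, tm_two_mul_add_one, Bool.not_inj_iff] at this
    · have alt : ∀ j < p, tm (i + j) ≠ tm (i + j + 1) := by
        intro j hj heq
        have h1 := h j (by omega)
        have h2 := h (j + 1) (by omega)
        rcases Nat.mod_two_eq_zero_or_one (i + j) with hi | hi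
        · exact tm_succ_ne_of_even hi heq
        · refine tm_succ_ne_of_even (i := i + j + p) (by omega) ?_
          rw [← h1, heq, show i + j + p + 1 = i + (j + 1) + p by omega, ← h2, add_assoc]
      have h1 := alternating_apply p alt
      have h2 := h 0 (by omega)
      simp only [add_zero] at h2
      rw [← h2] at h1
      simp [hp2] at h1

theorem eq_of_ne_of_ne {a b c : Bool} (h : a ≠ b) (h' : b ≠ c) : a = c := by
  revert h h'; cases a <;> cases b <;> cases c <;> simp

/-- The letters `V 0, …, V (n - 1)` form an overlap-free word of odd length `n`, aligned with
`μ` at its start, with prefix `0110` and suffix `0010`, each up to complement. -/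
structure Clipped (n : ℕ) (V : ℕ → Bool) : Prop where
  odd : n % 2 = 1
  five_le : 5 ≤ n
  aligned : ∀ i, i % 2 = 0 → i + 1 < n → V i ≠ V (i + 1)
  overlapFree : ∀ i p, 1 ≤ p → i + 2 * p < n → ¬ ∀ k ≤ p, V (i + k) = V (i + k + p)
  pre : V 1 = V 2
  suf : V (n - 4) = V (n - 3)
  suf' : V (n - 2) ≠ V (n - 1)

/-- The image of the sequence `W` under the complementary morphism given by `V 0 ⋯ V (n - 1)`. -/
def blockSeq (n : ℕ) (V W : ℕ → Bool) (i : ℕ) : Bool := W (i / n) ^^ V (i % n)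

/-- Positions `i` with `X (i - 1) = X i`, for `X = blockSeq n V W`. -/
def Flat (n : ℕ) (V W : ℕ → Bool) (i : ℕ) : Prop :=
  blockSeq n V W (i - 1) = blockSeq n V W i

theorem blockSeq_block {n : ℕ} {V W : ℕ → Bool} (m : ℕ) {s : ℕ} (hs : s < n) :
    blockSeq n V W (m * n + s) = (W m ^^ V s) := by
  unfold blockSeq
  have hn : 0 < n := by omega
  rw [mul_comm, Nat.mul_add_mod, Nat.mod_eq_of_lt hs, Nat.mul_add_div hn, Nat.div_eq_of_lt hs,
    add_zero]

theorem flat_block {n : ℕ} {V W : ℕ → Bool} (m : ℕ) {s : ℕ} (hs : s < n) (h0 : 1 ≤ s) :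
    Flat n V W (m * n + s) ↔ V (s - 1) = V s := by
  unfold Flat
  rw [show m * n + s - 1 = m * n + (s - 1) by omega, blockSeq_block m hs,
    blockSeq_block m (by omega : s - 1 < n), Bool.xor_right_inj]

theorem exists_block {n : ℕ} (hn : 0 < n) (i : ℕ) : ∃ m s, s < n ∧ i = m * n + s :=
  ⟨i / n, i % n, Nat.mod_lt _ hn, by rw [mul_comm]; exact (Nat.div_add_mod i n).symm⟩

namespace Clipped

variable {n : ℕ} {V : ℕ → Bool} (hV : Clipped n V) (W : ℕ → Bool)
include hV

theorem not_flat_odd (m : ℕ) {s : ℕ} (hs : s < n) (h : s % 2 = 1) : ¬ Flat n V W (m * n + s) := by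
  rw [flat_block m hs (by omega)]
  have := hV.aligned (s - 1) (by omega) (by omega)
  rwa [Nat.sub_add_cancel (by omega)] at this

theorem flat_two (m : ℕ) : Flat n V W (m * n + 2) := by
  have := hV.five_le
  rw [flat_block m (by omega) (by omega)]
  exact hV.pre

theorem flat_sub_three (m : ℕ) : Flat n V W (m * n + (n - 3)) := by
  have := hV.five_le
  rw [flat_block m (by omega) (by omega), show n - 3 - 1 = n - 4 by omega]
  exact hV.suf

theorem not_flat_last (m : ℕ) : ¬ Flat n V W (m * n + (n - 1)) := by
  have := hV.five_le
  rw [flat_block m (by omega) (by omega), show n - 1 - 1 = n - 2 by omega]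
  exact hV.suf'

theorem flat_or_flat (m : ℕ) {s : ℕ} (h2 : 2 ≤ s) (hs : s + 3 < n) (he : s % 2 = 0) :
    Flat n V W (m * n + s) ∨ Flat n V W (m * n + (s + 2)) := by
  rw [flat_block m (by omega) (by omega), flat_block m (by omega) (by omega)]
  by_contra! hc
  obtain ⟨c1, c2⟩ := hc
  have c3 := hV.aligned s he (by omega)
  have c4 := hV.aligned (s + 2) (by omega) (by omega)
  rw [show s + 2 - 1 = s + 1 by omega] at c2
  obtain ⟨r, rfl⟩ : ∃ r, s = r + 1 := ⟨s - 1, by omega⟩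
  refine hV.overlapFree r 2 (by omega) (by omega) fun k hk => ?_
  interval_cases k
  · exact eq_of_ne_of_ne c1 c3
  · exact eq_of_ne_of_ne c3 c2
  · exact eq_of_ne_of_ne c2 c4

theorem not_four_flats (m : ℕ) {s : ℕ} (h2 : 2 ≤ s) (hs : s + 7 < n) (he : s % 2 = 0)
    (f0 : Flat n V W (m * n + s)) (f1 : Flat n V W (m * n + (s + 2)))
    (f2 : Flat n V W (m * n + (s + 4))) (f3 : Flat n V W (m * n + (s + 6))) : False := by
  obtain ⟨r, rfl⟩ : ∃ r, s = r + 2 := ⟨s - 2, by omega⟩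
  rw [flat_block m (by omega) (by omega)] at f0 f1 f2 f3
  simp only [show r + 2 - 1 = r + 1 by omega, show r + 2 + 2 - 1 = r + 3 by omega,
    show r + 2 + 4 - 1 = r + 5 by omega, show r + 2 + 6 - 1 = r + 7 by omega, add_assoc,
    Nat.reduceAdd] at f0 f1 f2 f3
  have a0 := hV.aligned r (by omega) (by omega)
  have a1 := hV.aligned (r + 2) (by omega) (by omega)
  have a2 := hV.aligned (r + 4) (by omega) (by omega)
  have a3 := hV.aligned (r + 6) (by omega) (by omega)
  have a4 := hV.aligned (r + 8) (by omega) (by omega)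
  simp only [add_assoc, Nat.reduceAdd] at a0 a1 a2 a3 a4
  refine hV.overlapFree r 4 (by omega) (by omega) fun k hk => ?_
  interval_cases k
  · exact eq_of_ne_of_ne (f0 ▸ a0) (f1 ▸ a1)
  · exact f0.trans (eq_of_ne_of_ne a1 (f1 ▸ a2))
  · exact eq_of_ne_of_ne (f1 ▸ a1) (f2 ▸ a2)
  · exact f1.trans (eq_of_ne_of_ne a2 (f2 ▸ a3))
  · exact eq_of_ne_of_ne (f2 ▸ a2) (f3 ▸ a3)

/-- A flat position has even offset at most `n - 3` in its block. -/
theorem offset_of_flat {m s : ℕ} (hs : s < n) (h : Flat n V W (m * n + s)) :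
    s % 2 = 0 ∧ s + 3 ≤ n := by
  have h1 : ¬ s % 2 = 1 := fun h' => hV.not_flat_odd W m hs h' h
  have h2 : s ≠ n - 1 := by rintro rfl; exact hV.not_flat_last W m h
  have := hV.odd
  omega

theorem not_flat_flat_succ (i : ℕ) (h : Flat n V W i) (h1 : Flat n V W (i + 1)) : False := by
  have h5 := hV.five_le
  obtain ⟨m, s, hs, rfl⟩ := exists_block (by omega : 0 < n) i
  obtain ⟨e, l⟩ := hV.offset_of_flat W hs h
  exact hV.not_flat_odd W m (by omega : s + 1 < n) (by omega) h1

theorem exists_flat (i : ℕ) : ∃ k ≤ 4, Flat n V W (i + k) := by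
  have h5 := hV.five_le
  have hodd := hV.odd
  obtain ⟨m, s, hs, rfl⟩ := exists_block (by omega : 0 < n) i
  by_cases c1 : s ≤ 2
  · exact ⟨2 - s, by omega, by convert hV.flat_two W m using 1; omega⟩
  by_cases c2 : n - 3 < s
  · refine ⟨n + 2 - s, by omega, ?_⟩
    convert hV.flat_two W (m + 1) using 1
    rw [add_mul]; omega
  by_cases c3 : n - 3 ≤ s + 4
  · exact ⟨n - 3 - s, by omega, by convert hV.flat_sub_three W m using 1; omega⟩
  rcases Nat.mod_two_eq_zero_or_one s with e | e
  · rcases hV.flat_or_flat W m (by omega : 2 ≤ s) (by omega) e with h | h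
    · exact ⟨0, by omega, h⟩
    · exact ⟨2, by omega, h⟩
  · rcases hV.flat_or_flat W m (by omega : 2 ≤ s + 1) (by omega) (by omega) with h | h
    · exact ⟨1, by omega, h⟩
    · exact ⟨3, by omega, h⟩

theorem flat_add_five (i : ℕ) (h : Flat n V W i) (h3 : Flat n V W (i + 3)) :
    Flat n V W (i + 5) := by
  have h5 := hV.five_le
  have hodd := hV.odd
  obtain ⟨m, s, hs, rfl⟩ := exists_block (by omega : 0 < n) i
  obtain ⟨e, l⟩ := hV.offset_of_flat W hs h
  by_cases c : s + 3 < n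
  · exact (hV.not_flat_odd W m c (by omega) h3).elim
  · convert hV.flat_two W (m + 1) using 1
    rw [add_mul]; omega

theorem not_five_flats (i : ℕ) (f0 : Flat n V W i) (f1 : Flat n V W (i + 2))
    (f2 : Flat n V W (i + 4)) (f3 : Flat n V W (i + 6)) (f4 : Flat n V W (i + 8)) : False := by
  have h5 := hV.five_le
  obtain ⟨m, s, hs, rfl⟩ := exists_block (by omega : 0 < n) i
  have g0 := hV.offset_of_flat W hs f0
  have g1 := hV.offset_of_flat W (s := s + 2) (by omega) f1
  have g2 := hV.offset_of_flat W (s := s + 4) (by omega) f2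
  have g3 := hV.offset_of_flat W (s := s + 6) (by omega) f3
  have g4 := hV.offset_of_flat W (s := s + 8) (by omega) f4
  exact hV.not_four_flats W m (s := s + 2) (by omega) (by omega) (by omega) f1 f2 f3 f4

end Clipped

/-- The pattern of flat positions seen at the end of every block. -/
def Junction (n : ℕ) (V W : ℕ → Bool) (i : ℕ) : Prop :=
  Flat n V W i ∧ ¬ Flat n V W (i + 2) ∧ Flat n V W (i + 5)

namespace Clipped

variable {n : ℕ} {V : ℕ → Bool} (hV : Clipped n V) (W : ℕ → Bool)
include hV

theorem junction (m : ℕ) : Junction n V W (m * n + (n - 3)) := by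
  have h5 := hV.five_le
  refine ⟨hV.flat_sub_three W m, ?_, ?_⟩
  · convert hV.not_flat_last W m using 2; omega
  · convert hV.flat_two W (m + 1) using 1
    rw [add_mul]; omega

theorem exists_eq_of_junction (i : ℕ) (h : Junction n V W i) : ∃ m, i = m * n + (n - 3) := by
  have h5 := hV.five_le
  have hodd := hV.odd
  obtain ⟨f0, f2, f5⟩ := h
  obtain ⟨m, s, hs, rfl⟩ := exists_block (by omega : 0 < n) i
  obtain ⟨e, l⟩ := hV.offset_of_flat W hs f0
  refine ⟨m, ?_⟩
  by_cases c : s + 5 < n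
  · exact (hV.not_flat_odd W m c (by omega) f5).elim
  by_cases c' : s = n - 5
  · refine (f2 ?_).elim
    convert hV.flat_sub_three W m using 1; omega
  · omega

theorem dvd_of_junction {i p : ℕ} (h : Junction n V W i) (h' : Junction n V W (i + p)) :
    n ∣ p := by
  obtain ⟨m, hm⟩ := hV.exists_eq_of_junction W i h
  obtain ⟨k, hk⟩ := hV.exists_eq_of_junction W _ h'
  have : m * n + p = k * n := by omega
  exact (Nat.dvd_add_right (Dvd.intro_left m rfl)).1 (this ▸ Dvd.intro_left k rfl)

theorem flat_after_junction (hn : n ≠ 5) (i : ℕ) (h : Junction n V W i) :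
    Flat n V W (i + 7) ∨ Flat n V W (i + 9) := by
  have h5 := hV.five_le
  have hodd := hV.odd
  obtain ⟨m, rfl⟩ := hV.exists_eq_of_junction W i h
  have e7 : m * n + (n - 3) + 7 = (m + 1) * n + 4 := by rw [add_mul]; omega
  have e9 : m * n + (n - 3) + 9 = (m + 1) * n + (4 + 2) := by rw [add_mul]; omega
  rw [e7, e9]
  by_cases c : n = 7
  · left
    convert hV.flat_sub_three W (m + 1) using 1; omega
  · exact hV.flat_or_flat W (m + 1) (by omega) (by omega) (by omega)

/-- The period of a cube in a complementary image of a clipped word is a multiple of the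
block length. -/
theorem dvd_of_cube {a p : ℕ} (hp : 1 ≤ p)
    (hc : ∀ k < 2 * p, blockSeq n V W (a + k) = blockSeq n V W (a + k + p)) : n ∣ p := by
  have h5 := hV.five_le
  have hF : ∀ i, a < i → i < a + 2 * p → (Flat n V W i ↔ Flat n V W (i + p)) := by
    intro i h1 h2
    have e1 := hc (i - 1 - a) (by omega)
    have e2 := hc (i - a) (by omega)
    rw [show a + (i - 1 - a) = i - 1 by omega, show i - 1 + p = i + p - 1 by omega] at e1
    rw [show a + (i - a) = i by omega] at e2
    unfold Flat
    rw [e1, e2]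
  rcases le_or_gt 6 p with h6 | h6
  · obtain ⟨m, s, hs, hm⟩ := exists_block (by omega : 0 < n) (a + 3)
    have hJ : ∀ i, a < i → i + 5 < a + 2 * p → (Junction n V W i ↔ Junction n V W (i + p)) := by
      intro i h1 h2
      unfold Junction
      rw [hF i h1 (by omega), hF (i + 2) (by omega) (by omega), hF (i + 5) (by omega) (by omega),
        add_right_comm i 2, add_right_comm i 5]
    have hj := hV.junction W m
    by_cases c : m * n + (n - 3) + 5 < a + 3 * p
    · by_cases c' : m * n + (n - 3) + 5 < a + 2 * p
      · exact hV.dvd_of_junction W hj ((hJ _ (by omega) c').1 hj)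
      · have e : m * n + (n - 3) = m * n + (n - 3) - p + p := by omega
        rw [e] at hj
        exact hV.dvd_of_junction W ((hJ _ (by omega) (by omega)).2 hj) hj
    · exfalso
      refine hV.overlapFree (s - 3) p hp (by omega) fun k hk => ?_
      have := hc (m * n + (s - 3) - a + k) (by omega)
      rwa [show a + (m * n + (s - 3) - a + k) = m * n + (s - 3 + k) by omega, add_assoc (m * n),
        blockSeq_block m (by omega), blockSeq_block m (by omega), Bool.xor_right_inj] at this
  · have adj := fun k h h' => hV.not_flat_flat_succ W (a + 1 + k) h h'
    have hX : ∀ k, Flat n V W (a + 1 + k) ↔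
        blockSeq n V W (a + k) = blockSeq n V W (a + k + 1) := by
      intro k
      rw [Flat, show a + 1 + k - 1 = a + k by omega, add_right_comm]
    have hF' : ∀ k, k + 1 < 2 * p → (Flat n V W (a + 1 + k) ↔ Flat n V W (a + 1 + k + p)) :=
      fun k hk => hF _ (by omega) (by omega)
    obtain ⟨f, hf⟩ : ∃ f : ℕ → Prop, ∀ k, f k ↔ Flat n V W (a + 1 + k) := ⟨_, fun _ => Iff.rfl⟩
    have hgap : f 0 ∨ f 1 ∨ f 2 ∨ f 3 ∨ f 4 := by
      obtain ⟨k, hk, h⟩ := hV.exists_flat W (a + 1)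
      rw [← hf] at h
      interval_cases k <;> tauto
    have hthree := fun k => hV.flat_add_five W (a + 1 + k)
    have hfive := fun k => hV.not_five_flats W (a + 1 + k)
    have hjun := fun hn k => hV.flat_after_junction W hn (a + 1 + k)
    have h0 := hc 0 (by omega)
    unfold Junction at hjun
    obtain ⟨y, hy⟩ : ∃ y : ℕ → Bool, ∀ k, y k = blockSeq n V W (a + k) := ⟨_, fun _ => rfl⟩
    rw [add_zero, ← add_zero a, add_assoc, zero_add, ← hy, ← hy] at h0
    simp only [add_assoc (a + 1), ← hf] at adj hX hF' hthree hfive hjun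
    simp only [add_assoc a, ← hy] at hX
    clear hF hf hc hy
    have x0 := hX 0
    have x1 := hX 1
    have x2 := hX 2
    have x3 := hX 3
    have x4 := hX 4
    have q0 := @eq_of_ne_of_ne (y 0) (y 1) (y 2)
    have q1 := @eq_of_ne_of_ne (y 1) (y 2) (y 3)
    have q2 := @eq_of_ne_of_ne (y 2) (y 3) (y 4)
    have q3 := @eq_of_ne_of_ne (y 3) (y 4) (y 5)
    have adj0 := adj 0
    have adj1 := adj 1
    have adj2 := adj 2
    have adj3 := adj 3
    have adj4 := adj 4
    interval_cases p
    · exfalso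
      have e0 := hF' 0 (by omega)
      clear hF' hX adj hthree hfive hjun
      simp only [zero_add, Nat.reduceAdd] at *
      grind
    · exfalso
      have e0 := hF' 0 (by omega)
      have e1 := hF' 1 (by omega)
      have e2 := hF' 2 (by omega)
      clear hF' hX adj hthree hfive hjun
      simp only [zero_add, Nat.reduceAdd] at *
      grind
    · exfalso
      have e0 := hF' 0 (by omega)
      have e1 := hF' 1 (by omega)
      have e2 := hF' 2 (by omega)
      have e3 := hF' 3 (by omega)
      have e4 := hF' 4 (by omega)
      have t0 := hthree 0
      have t1 := hthree 1
      have t2 := hthree 2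
      clear hF' hX adj hthree hfive hjun
      simp only [zero_add, Nat.reduceAdd] at *
      grind
    · exfalso
      have e0 := hF' 0 (by omega)
      have e1 := hF' 1 (by omega)
      have e2 := hF' 2 (by omega)
      have e3 := hF' 3 (by omega)
      have e4 := hF' 4 (by omega)
      have e5 := hF' 5 (by omega)
      have t0 := hfive 0
      have t1 := hfive 1
      clear hF' hX adj hthree hfive hjun
      simp only [zero_add, Nat.reduceAdd] at *
      grind
    · by_contra hn
      have hn5 : n ≠ 5 := by rintro rfl; simp at hn
      have e0 := hF' 0 (by omega)
      have e1 := hF' 1 (by omega)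
      have e2 := hF' 2 (by omega)
      have e3 := hF' 3 (by omega)
      have e4 := hF' 4 (by omega)
      have e5 := hF' 5 (by omega)
      have e6 := hF' 6 (by omega)
      have e7 := hF' 7 (by omega)
      have e8 := hF' 8 (by omega)
      have t0 := hjun hn5 0
      have t1 := hjun hn5 1
      have t2 := hjun hn5 2
      have t3 := hjun hn5 3
      have t4 := hjun hn5 4
      clear hF' hX adj hthree hfive hjun
      simp only [zero_add, Nat.reduceAdd] at *
      grind

end Clipped

/-- `w` contains no factor of the form `yyy` with `y` nonempty. -/
def CubeFree (w : List Bool) : Prop :=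
  ∀ a p, 1 ≤ p → a + 3 * p ≤ w.length →
    ¬ ∀ k < 2 * p, w.getD (a + k) false = w.getD (a + k + p) false

theorem hasPeriodW_per {x : List Bool} (hx : x ≠ []) : HasPeriodW x (per x) := by
  have h := List.length_pos_of_ne_nil hx
  exact Nat.sInf_mem (s := {p | HasPeriodW x p}) ⟨x.length, h, le_rfl, fun i hi => by omega⟩

theorem cubeFree_of_ce_lt {w : List Bool} (h : ce w < 3) : CubeFree w := by
  intro a p hp ha hc
  have hbdd : BddAbove {r : ℝ | ∃ x : List Bool, x ≠ [] ∧ x <:+: w ∧ r = wexp x} := by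
    refine ⟨w.length, ?_⟩
    rintro r ⟨x, hx, hxw, rfl⟩
    have h1 : (1 : ℝ) ≤ per x := by exact_mod_cast (hasPeriodW_per hx).1
    have h2 : (x.length : ℝ) ≤ w.length := by exact_mod_cast hxw.length_le
    exact (div_le_self (by positivity) h1).trans h2
  let x := (w.drop a).take (3 * p)
  have hlen : x.length = 3 * p := by simp only [x, List.length_take, List.length_drop]; omega
  have hx : x ≠ [] := by rintro hx; rw [hx, List.length_nil] at hlen; omega
  have hget : ∀ i < 3 * p, x.getD i false = w.getD (a + i) false := by
    intro i hi
    simp [x, List.getD_eq_getElem?_getD, hi, List.getElem?_drop]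
  have hper : per x ≤ p := by
    refine Nat.sInf_le ⟨hp, by omega, fun i hi => ?_⟩
    rw [hget i (by omega), hget (i + p) (by omega), hc i (by omega), add_assoc]
  have hle : wexp x ≤ ce w := le_csSup hbdd
    ⟨x, hx, (List.take_prefix _ _).isInfix.trans (List.drop_suffix _ _).isInfix, rfl⟩
  have h1 : (1 : ℝ) ≤ per x := by exact_mod_cast (hasPeriodW_per hx).1
  have h2 : (per x : ℝ) ≤ p := by exact_mod_cast hper
  have h3 : (3 : ℝ) ≤ wexp x := by
    rw [wexp, le_div_iff₀ (by linarith), hlen]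
    push_cast
    linarith
  linarith

theorem ce_lt_of_cubeFree {w : List Bool} (h : CubeFree w) : ce w < 3 := by
  unfold ce
  set S := {r : ℝ | ∃ x : List Bool, x ≠ [] ∧ x <:+: w ∧ r = wexp x}
  have hfin : S.Finite := by
    refine (w.sublists.toFinset.finite_toSet.image wexp).subset ?_
    rintro r ⟨x, -, hxw, rfl⟩
    exact ⟨x, by simpa using hxw.sublist, rfl⟩
  rcases S.eq_empty_or_nonempty with hS | hS
  · rw [hS, Real.sSup_empty]; norm_num
  obtain ⟨x, hx, ⟨u, v, rfl⟩, hr⟩ := hS.csSup_mem hfin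
  rw [hr]
  by_contra! hc
  obtain ⟨h1, h2, h3⟩ := hasPeriodW_per hx
  have h1' : (0 : ℝ) < per x := by exact_mod_cast h1
  rw [wexp, le_div_iff₀ h1'] at hc
  have hc' : 3 * per x ≤ x.length := by exact_mod_cast hc
  have hget : ∀ i < x.length, (u ++ x ++ v).getD (u.length + i) false = x.getD i false := by
    intro i hi
    rw [List.append_assoc, List.getD_append_right _ _ _ _ (by omega),
      List.getD_append _ _ _ _ (by omega), Nat.add_sub_cancel_left]
  refine h u.length (per x) h1 (by simp only [List.length_append]; omega) fun k hk => ?_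
  rw [hget k (by omega), add_assoc, hget _ (by omega)]
  exact h3 k (by omega)

theorem ce_lt_iff_cubeFree {w : List Bool} : ce w < 3 ↔ CubeFree w :=
  ⟨cubeFree_of_ce_lt, ce_lt_of_cubeFree⟩

theorem CubeFree.reverse {w : List Bool} (h : CubeFree w) : CubeFree w.reverse := by
  intro a p hp ha hc
  rw [List.length_reverse] at ha
  refine h (w.length - a - 3 * p) p hp (by omega) fun k hk => ?_
  have := hc (2 * p - 1 - k) (by omega)
  rw [List.getD_reverse _ (by omega), List.getD_reverse _ (by omega)] at this
  convert this.symm using 2 <;> omega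

theorem applyMorph_cons (h0 h1 : List Bool) (b : Bool) (w : List Bool) :
    applyMorph h0 h1 (b :: w) = (bif b then h1 else h0) ++ applyMorph h0 h1 w := by
  simp [applyMorph]

theorem applyMorph_append (h0 h1 w w' : List Bool) :
    applyMorph h0 h1 (w ++ w') = applyMorph h0 h1 w ++ applyMorph h0 h1 w' := by
  simp [applyMorph]

theorem reverse_applyMorph (h0 h1 w : List Bool) :
    (applyMorph h0 h1 w).reverse = applyMorph h0.reverse h1.reverse w.reverse := by
  induction w with
  | nil => simp [applyMorph]
  | cons b w ih =>
    rw [applyMorph_cons, List.reverse_append, ih, List.reverse_cons, applyMorph_append]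
    cases b <;> simp [applyMorph]

theorem CubefreeC.of_reverse {v : List Bool} (h : CubefreeC v.reverse) : CubefreeC v := by
  intro w hw
  rw [ce_lt_iff_cubeFree] at hw ⊢
  have := ce_lt_iff_cubeFree.1 (h w.reverse (ce_lt_iff_cubeFree.2 hw.reverse))
  rw [show wcompl v.reverse = (wcompl v).reverse from List.map_reverse, ← reverse_applyMorph]
    at this
  simpa using this.reverse

theorem length_applyMorph_wcompl (v w : List Bool) :
    (applyMorph v (wcompl v) w).length = w.length * v.length := by
  induction w with
  | nil => simp [applyMorph]
  | cons b w ih =>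
    rw [applyMorph_cons, List.length_append, ih, List.length_cons, add_mul]
    cases b <;> simp [wcompl, add_comm]

theorem getD_applyMorph_wcompl (v w : List Bool) (i : ℕ) (hi : i < w.length * v.length) :
    (applyMorph v (wcompl v) w).getD i false =
      blockSeq v.length (v.getD · false) (w.getD · false) i := by
  induction w generalizing i with
  | nil => simp at hi
  | cons b w ih =>
    have hv : 0 < v.length := Nat.pos_of_ne_zero fun h => by simp [h] at hi
    have hb : (bif b then wcompl v else v).length = v.length := by cases b <;> simp [wcompl]
    rw [applyMorph_cons]
    rcases lt_or_ge i v.length with h | h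
    · rw [List.getD_append _ _ _ _ (by omega), blockSeq, Nat.div_eq_of_lt h, Nat.mod_eq_of_lt h]
      cases b <;> simp [wcompl, List.getD_eq_getElem?_getD, h]
    · obtain ⟨j, rfl⟩ : ∃ j, i = j + v.length := ⟨i - v.length, by omega⟩
      rw [List.length_cons, add_mul] at hi
      rw [List.getD_append_right _ _ _ _ (by omega), hb, Nat.add_sub_cancel, ih j (by omega),
        blockSeq, blockSeq, Nat.add_div_right _ hv, Nat.add_mod_right]
      simp

theorem Clipped.cubefreeC {v : List Bool} (hV : Clipped v.length (v.getD · false)) :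
    CubefreeC v := by
  intro w hw
  rw [ce_lt_iff_cubeFree] at hw ⊢
  intro a p hp ha hc
  have h5 := hV.five_le
  set n := v.length with hn
  rw [length_applyMorph_wcompl] at ha
  have hc' : ∀ k < 2 * p, blockSeq n (v.getD · false) (w.getD · false) (a + k) =
      blockSeq n (v.getD · false) (w.getD · false) (a + k + p) := by
    intro k hk
    rw [← getD_applyMorph_wcompl _ _ _ (by omega), ← getD_applyMorph_wcompl _ _ _ (by omega)]
    exact hc k hk
  obtain ⟨q, rfl⟩ := hV.dvd_of_cube _ hp hc'
  have hq : 1 ≤ q := Nat.pos_of_mul_pos_left hp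
  obtain ⟨b, s, hs, rfl⟩ := exists_block (by omega : 0 < n) a
  refine hw b q hq ?_ fun k hk => ?_
  · by_contra! hlt
    have : (w.length + 1) * n ≤ (b + 3 * q) * n := Nat.mul_le_mul_right _ hlt
    nlinarith
  · have key : ∀ r < n, b * n + s ≤ (b + k) * n + r → (b + k) * n + r < b * n + s + 2 * (n * q) →
        w.getD (b + k) false = w.getD (b + k + q) false := by
      intro r hr h1 h2
      have := hc' ((b + k) * n + r - (b * n + s)) (by omega)
      rw [Nat.add_sub_cancel' h1, blockSeq_block _ hr,
        show (b + k) * n + r + n * q = (b + k + q) * n + r by ring, blockSeq_block _ hr,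
        Bool.xor_left_inj] at this
      exact this
    have hnq : n ≤ n * q := Nat.le_mul_of_pos_right _ hq
    rcases Nat.eq_zero_or_pos k with rfl | hk0
    · exact key s hs (by simp) (by simp; omega)
    · have h1 : 1 * n ≤ k * n := Nat.mul_le_mul_right _ hk0
      have h2 : (k + 1) * n ≤ (2 * q) * n := Nat.mul_le_mul_right _ hk
      exact key 0 (by omega) (by rw [add_mul]; omega) (by nlinarith)

theorem getD_tmFactor {ℓ k i : ℕ} (hi : i < k) : (tmFactor ℓ k).getD i false = tm (ℓ + i) := by
  simp [tmFactor, List.getD_eq_getElem?_getD, hi]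

theorem getD_of_prefix {u v : List Bool} (h : u <+: v) {i : ℕ} (hi : i < u.length) :
    v.getD i false = u.getD i false := by
  obtain ⟨t, rfl⟩ := h
  exact List.getD_append _ _ _ _ hi

theorem getD_of_suffix {u v : List Bool} (h : u <:+ v) {i : ℕ} :
    v.getD (v.length - u.length + i) false = u.getD i false := by
  obtain ⟨t, rfl⟩ := h
  rw [List.length_append, Nat.add_sub_cancel, List.getD_append_right _ _ _ _ (by omega),
    Nat.add_sub_cancel_left]

theorem odd_of_tm_eq_succ {i : ℕ} (h : tm i = tm (i + 1)) : i % 2 = 1 := by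
  by_contra h'
  exact tm_succ_ne_of_even (by omega) h

theorem clipped_tm {ℓ n : ℕ} {V : ℕ → Bool} (hV : ∀ i < n, V i = tm (ℓ + i)) (h4 : 4 ≤ n)
    (pre : V 1 = V 2) (suf : V (n - 4) = V (n - 3)) (suf' : V (n - 2) ≠ V (n - 1)) :
    Clipped n V := by
  have h1 : (ℓ + 1) % 2 = 1 := odd_of_tm_eq_succ (by
    rwa [hV 1 (by omega), hV 2 (by omega)] at pre)
  have h2 : (ℓ + (n - 4)) % 2 = 1 := odd_of_tm_eq_succ (by
    rw [hV _ (by omega), hV _ (by omega)] at suf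
    rw [suf]; congr 1; omega)
  refine ⟨by omega, by omega, fun i hi hin => ?_, fun i p hp hip h => ?_, pre, suf, suf'⟩
  · rw [hV _ (by omega), hV _ (by omega)]
    exact tm_succ_ne_of_even (by omega)
  · refine tm_overlapFree p (ℓ + i) hp fun k hk => ?_
    have := h k hk
    rw [hV _ (by omega), hV _ (by omega)] at this
    simpa only [add_assoc] using this

theorem clipped_tm_reverse {ℓ n : ℕ} {V : ℕ → Bool} (hV : ∀ i < n, V i = tm (ℓ + (n - 1 - i)))
    (h4 : 4 ≤ n) (pre : V 1 = V 2) (suf : V (n - 4) = V (n - 3)) (suf' : V (n - 2) ≠ V (n - 1)) :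
    Clipped n V := by
  have h1 : (ℓ + (n - 3)) % 2 = 1 := odd_of_tm_eq_succ (by
    rw [hV 1 (by omega), hV 2 (by omega)] at pre
    rw [show ℓ + (n - 3) = ℓ + (n - 1 - 2) by omega, ← pre]; congr 1; omega)
  have h2 : (ℓ + 2) % 2 = 1 := odd_of_tm_eq_succ (by
    rw [hV _ (by omega), hV _ (by omega)] at suf
    rw [show ℓ + 2 = ℓ + (n - 1 - (n - 3)) by omega, ← suf]; congr 1; omega)
  refine ⟨by omega, by omega, fun i _ hin => ?_, fun i p hp hip h => ?_, pre, suf, suf'⟩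
  · rw [hV _ (by omega), hV _ (by omega), show ℓ + (n - 1 - i) = ℓ + (n - 1 - (i + 1)) + 1 by omega]
    exact (tm_succ_ne_of_even (by omega)).symm
  · refine tm_overlapFree p (ℓ + (n - 1 - i - 2 * p)) hp fun k hk => ?_
    have := h (p - k) (by omega)
    rw [hV _ (by omega), hV _ (by omega)] at this
    convert this.symm using 2 <;> omega

/-- if `v` is a factor of the Thue–Morse word having
(a) prefix `0110` or `1001` and suffix `0010` or `1101`, or
(b) prefix `0100` or `1011` and suffix `0110` or `1001`,
then the clipped Thue–Morse morphism `f_v` is cubefree. -/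
theorem stmt14 (v : List Bool) (hv : IsTMFactor v)
    (hcond :
      ((([false, true, true, false] <+: v) ∨ ([true, false, false, true] <+: v)) ∧
       (([false, false, true, false] <:+ v) ∨ ([true, true, false, true] <:+ v))) ∨
      ((([false, true, false, false] <+: v) ∨ ([true, false, true, true] <+: v)) ∧
       (([false, true, true, false] <:+ v) ∨ ([true, false, false, true] <:+ v)))) :
    CubefreeC v := by
  obtain ⟨ℓ, hℓ⟩ := hv
  have hget : ∀ i < v.length, v.getD i false = tm (ℓ + i) := by
    intro i hi
    rw [hℓ, getD_tmFactor hi]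
  rcases hcond with ⟨hpre, hsuf⟩ | ⟨hpre, hsuf⟩
  · have h4 : 4 ≤ v.length := by rcases hpre with h | h <;> exact h.length_le
    refine (clipped_tm hget h4 ?_ ?_ ?_).cubefreeC
    · rcases hpre with h | h <;>
        exact (getD_of_prefix h (i := 1) (by simp)).trans
          (getD_of_prefix h (i := 2) (by simp)).symm
    · rw [show v.length - 4 = v.length - 4 + 0 by omega,
        show v.length - 3 = v.length - 4 + 1 by omega]
      rcases hsuf with h | h <;>
        exact (getD_of_suffix h (i := 0)).trans
          (getD_of_suffix h (i := 1)).symm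
    · rw [show v.length - 2 = v.length - 4 + 2 by omega,
        show v.length - 1 = v.length - 4 + 3 by omega]
      rcases hsuf with h | h <;>
        exact (getD_of_suffix h (i := 2)).trans_ne
          (Ne.trans_eq (by simp) (getD_of_suffix h (i := 3)).symm)
  · have h4 : 4 ≤ v.length := by rcases hpre with h | h <;> exact h.length_le
    refine CubefreeC.of_reverse (Clipped.cubefreeC ?_)
    rw [List.length_reverse]
    have hrev : ∀ i < v.length, v.reverse.getD i false = v.getD (v.length - 1 - i) false :=
      fun i hi => by rw [List.getD_reverse _ hi]
    refine clipped_tm_reverse (ℓ := ℓ) (fun i hi => ?_) h4 ?_ ?_ ?_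
    · rw [hrev i hi, hget _ (by omega)]
    · rw [hrev _ (by omega), hrev _ (by omega), show v.length - 1 - 1 = v.length - 4 + 2 by omega,
        show v.length - 1 - 2 = v.length - 4 + 1 by omega]
      rcases hsuf with h | h <;>
        exact (getD_of_suffix h (i := 2)).trans
          (getD_of_suffix h (i := 1)).symm
    · rw [hrev _ (by omega), hrev _ (by omega), show v.length - 1 - (v.length - 4) = 3 by omega,
        show v.length - 1 - (v.length - 3) = 2 by omega]
      rcases hpre with h | h <;>
        exact (getD_of_prefix h (i := 3) (by simp)).trans
          (getD_of_prefix h (i := 2) (by simp)).symm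
    · rw [hrev _ (by omega), hrev _ (by omega), show v.length - 1 - (v.length - 2) = 1 by omega,
        show v.length - 1 - (v.length - 1) = 0 by omega]
      rcases hpre with h | h <;>
        rw [getD_of_prefix h (i := 1) (by simp), getD_of_prefix h (i := 0) (by simp)] <;> simp
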